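/- arXiv:1603.03415 — 2 statements merged into one kernel-verified Lean document; each statement's English description precedes it below -/
import Mathlib

section
/- Let μ_j (j ∈ ℕ) and μ be Radon measures on ℝ^d, all doubling with the same constant C > 0, with supports Σ_j and Σ, let B be a ball with Σ ∩ B ≠ ∅ and Σ_j ∩ B ≠ ∅ for all j, and let n be an integer with 0 < n ≤ d. If μ_j ⇀ μ, then (1/2)·limsup_{j→∞} β^n_{μ_j}((1/2)B) ≤ β^n_μ(B) ≤ 2·liminf_{j→∞} β^n_{μ_j}(2B), where (1/2)B and 2B denote the concentric balls of half and twice the radius of B. -/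
open MeasureTheory Metric Filter Set

noncomputable section

abbrev Euc (d : ℕ) : Type := EuclideanSpace ℝ (Fin d)

/-- The support of a measure: points all of whose closed balls have positive measure. -/
def msupport {d : ℕ} (μ : Measure (Euc d)) : Set (Euc d) :=
  {x | ∀ r : ℝ, 0 < r → 0 < μ (Metric.closedBall x r)}

/-- `φ` is a distribution function of the uniformly distributed measure `μ`. -/
def IsDistributionFunction {d : ℕ} (μ : Measure (Euc d)) (φ : ℝ → ENNReal) : Prop :=
  (msupport μ).Nonempty ∧
  (∀ r : ℝ, 0 < r → 0 < φ r ∧ φ r < ⊤) ∧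
  (∀ x ∈ msupport μ, ∀ r : ℝ, 0 < r → μ (Metric.closedBall x r) = φ r)

/-- `μ` is uniformly distributed. -/
def UniformlyDistributed {d : ℕ} (μ : Measure (Euc d)) : Prop :=
  ∃ φ : ℝ → ENNReal, IsDistributionFunction μ φ

/-- `dim₀ μ = n` : the limit of `φ(r)/rⁿ` as `r → 0⁺` exists, is finite and positive. -/
def HasDim0 (φ : ℝ → ENNReal) (n : ℕ) : Prop :=
  ∃ c : ℝ, 0 < c ∧
    Filter.Tendsto (fun r : ℝ => (φ r).toReal / r ^ n) (nhdsWithin 0 (Set.Ioi 0)) (nhds c)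

/-- `dim_∞ μ = p` : the limit of `φ(r)/r^p` as `r → ∞` exists, is finite and positive. -/
def HasDimInfty (φ : ℝ → ENNReal) (p : ℕ) : Prop :=
  ∃ c : ℝ, 0 < c ∧
    Filter.Tendsto (fun r : ℝ => (φ r).toReal / r ^ p) Filter.atTop (nhds c)

/-- The affine `n`-planes of `ℝ^d`. -/
def nPlanes (d n : ℕ) : Set (AffineSubspace ℝ (Euc d)) :=
  {L | (L : Set (Euc d)).Nonempty ∧ Module.finrank ℝ L.direction = n}

/-- Jones' beta number `β^n_μ(B(x,r))`. -/
def jonesBeta {d : ℕ} (n : ℕ) (μ : Measure (Euc d)) (x : Euc d) (r : ℝ) : ℝ :=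
  ⨅ L : nPlanes d n,
    ⨆ y : (msupport μ ∩ Metric.closedBall x r : Set (Euc d)),
      Metric.infDist y.1 (L.1 : Set (Euc d)) / r

/-- The bilateral beta number `bβ^n_μ(B(x,r))`. -/
def bilateralBeta {d : ℕ} (n : ℕ) (μ : Measure (Euc d)) (x : Euc d) (r : ℝ) : ℝ :=
  ⨅ L : nPlanes d n,
    ((⨆ y : (msupport μ ∩ Metric.closedBall x r : Set (Euc d)),
        Metric.infDist y.1 (L.1 : Set (Euc d)) / r) +
     (⨆ p : ((L.1 : Set (Euc d)) ∩ Metric.closedBall x r : Set (Euc d)),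
        Metric.infDist p.1 (msupport μ) / r))

/-- `μ` is doubling with constant `C`. -/
def DoublingWith {d : ℕ} (μ : Measure (Euc d)) (C : ℝ) : Prop :=
  ∀ x ∈ msupport μ, ∀ r : ℝ, 0 < r →
    μ (Metric.closedBall x (2 * r)) ≤ ENNReal.ofReal C * μ (Metric.closedBall x r)

/-- `μ` is doubling. -/
def Doubling {d : ℕ} (μ : Measure (Euc d)) : Prop :=
  ∃ C : ℝ, 0 < C ∧ DoublingWith μ C

/-- Weak convergence of a sequence of Radon measures. -/
def WeakConv {d : ℕ} (μs : ℕ → Measure (Euc d)) (μ : Measure (Euc d)) : Prop :=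
  ∀ f : Euc d → ℝ, Continuous f → HasCompactSupport f →
    Filter.Tendsto (fun j => ∫ x, f x ∂(μs j)) Filter.atTop (nhds (∫ x, f x ∂μ))

/-- `μ` is `n`-asymptotically optimally doubling. -/
def AsympOptDoubling {d : ℕ} (n : ℕ) (μ : Measure (Euc d)) : Prop :=
  ∀ K : Set (Euc d), IsCompact K → K ⊆ msupport μ →
    ∀ t : ℝ, t ∈ Set.Icc (1/2 : ℝ) 1 →
      Filter.Tendsto
        (fun r : ℝ => ⨆ x : K,
          |(μ (Metric.closedBall x.1 (t * r)) / μ (Metric.closedBall x.1 r)).toReal - t ^ n|)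
        (nhdsWithin 0 (Set.Ioi 0)) (nhds 0)

/-- Truncated `n`-Riesz transform `R_{r,s}μ(z)`. -/
def rieszT {d : ℕ} (n : ℕ) (μ : Measure (Euc d)) (z : Euc d) (r s : ℝ) : Euc d :=
  ∫ y in {y : Euc d | r ≤ dist y z ∧ dist y z ≤ s}, (‖y - z‖ ^ (n + 1))⁻¹ • (y - z) ∂μ

/-- `μ` is locally Ahlfors `n`-regular. -/
def LocallyAhlforsRegular {d : ℕ} (n : ℕ) (μ : Measure (Euc d)) : Prop :=
  ∀ K : Set (Euc d), IsCompact K → ∃ c : ℝ, 0 < c ∧ ∃ rK : ℝ, 0 < rK ∧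
    ∀ x ∈ msupport μ ∩ K, ∀ r : ℝ, 0 < r → r ≤ rK →
      ENNReal.ofReal (c⁻¹ * r ^ n) ≤ μ (Metric.closedBall x r) ∧
      μ (Metric.closedBall x r) ≤ ENNReal.ofReal (c * r ^ n)

/-- `μ` is locally uniformly `n`-rectifiable. -/
def LocUnifRectifiable {d : ℕ} (n : ℕ) (μ : Measure (Euc d)) : Prop :=
  LocallyAhlforsRegular n μ ∧
  ∀ K : Set (Euc d), IsCompact K →
    ∃ RK θK MK : ℝ, 0 < RK ∧ 0 < θK ∧ 0 < MK ∧
      ∀ x ∈ msupport μ ∩ K, ∀ R : ℝ, 0 < R → R ≤ RK →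
        ∃ g : EuclideanSpace ℝ (Fin n) → Euc d,
          LipschitzWith (Real.toNNReal MK) g ∧
          ENNReal.ofReal (θK * R ^ n) ≤ μ (Metric.closedBall x R ∩ Set.range g)

lemma measureReal_closedBall_bump_bounds {d : ℕ} (ν : Measure (Euc d)) [IsLocallyFiniteMeasure ν]
    (p : Euc d) {ε : ℝ} (hε : 0 < ε) :
    ε / 2 * ν.real (closedBall p (ε / 2)) ≤ ∫ x, max 0 (ε - dist x p) ∂ν ∧
      ∫ x, max 0 (ε - dist x p) ∂ν ≤ ε * ν.real (closedBall p ε) := by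
  have hint (r c : ℝ) : Integrable ((closedBall p r).indicator fun _ => c) ν :=
    (integrable_indicator_iff measurableSet_closedBall).2
      (integrableOn_const measure_closedBall_lt_top.ne)
  have hval (r c : ℝ) : ∫ x, (closedBall p r).indicator (fun _ => c) x ∂ν =
      c * ν.real (closedBall p r) := by
    rw [integral_indicator_const _ measurableSet_closedBall, smul_eq_mul, mul_comm]
  have hle (x : Euc d) :
      max 0 (ε - dist x p) ≤ (closedBall p ε).indicator (fun _ => ε) x := by
    by_cases hx : x ∈ closedBall p ε
    · rw [indicator_of_mem hx]
      exact max_le hε.le (sub_le_self _ dist_nonneg)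
    · rw [indicator_of_notMem hx]
      rw [mem_closedBall, not_le] at hx
      exact max_le le_rfl (by linarith)
  have hge (x : Euc d) :
      (closedBall p (ε / 2)).indicator (fun _ => ε / 2) x ≤ max 0 (ε - dist x p) := by
    by_cases hx : x ∈ closedBall p (ε / 2)
    · rw [indicator_of_mem hx]
      rw [mem_closedBall] at hx
      exact le_max_of_le_right (by linarith)
    · rw [indicator_of_notMem hx]
      exact le_max_left _ _
  have hbump : Integrable (fun x => max 0 (ε - dist x p)) ν := by
    refine (hint ε ε).mono' (by fun_prop) (ae_of_all _ fun x => ?_)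
    rw [Real.norm_of_nonneg (le_max_left _ _)]
    exact hle x
  rw [← hval, ← hval]
  exact ⟨integral_mono (hint _ _) hbump hge, integral_mono hbump (hint _ _) hle⟩

lemma WeakConv.tendsto_bump {d : ℕ} {μs : ℕ → Measure (Euc d)} {μ : Measure (Euc d)}
    (hconv : WeakConv μs μ) (p : Euc d) (ε : ℝ) :
    Tendsto (fun j => ∫ x, max 0 (ε - dist x p) ∂μs j) atTop
      (nhds (∫ x, max 0 (ε - dist x p) ∂μ)) := by
  refine hconv _ (by fun_prop)
    (HasCompactSupport.intro (isCompact_closedBall p ε) fun x hx => max_eq_left ?_)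
  rw [mem_closedBall, not_le] at hx
  linarith

lemma WeakConv.exists_pos_le_measureReal {d : ℕ} {μs : ℕ → Measure (Euc d)}
    {μ : Measure (Euc d)} [IsLocallyFiniteMeasure μ] (hls : ∀ j, IsLocallyFiniteMeasure (μs j))
    (hconv : WeakConv μs μ) {p : Euc d} (hp : p ∈ msupport μ) {ε : ℝ} (hε : 0 < ε) :
    ∃ c > 0, ∀ᶠ j in atTop, c ≤ (μs j).real (closedBall p ε) := by
  have hpos : 0 < μ.real (closedBall p (ε / 2)) :=
    ENNReal.toReal_pos (hp _ (half_pos hε)).ne' measure_closedBall_lt_top.ne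
  have hI : 0 < ∫ x, max 0 (ε - dist x p) ∂μ :=
    (mul_pos (half_pos hε) hpos).trans_le (measureReal_closedBall_bump_bounds μ p hε).1
  refine ⟨(∫ x, max 0 (ε - dist x p) ∂μ) / 2 / ε, by positivity, ?_⟩
  filter_upwards [(hconv.tendsto_bump p ε).eventually (lt_mem_nhds (half_lt_self hI))] with j hj
  have := hls j
  rw [div_le_iff₀' hε]
  exact hj.le.trans (measureReal_closedBall_bump_bounds (μs j) p hε).2

lemma WeakConv.eventually_measureReal_lt {d : ℕ} {μs : ℕ → Measure (Euc d)}
    {μ : Measure (Euc d)} [IsLocallyFiniteMeasure μ] (hls : ∀ j, IsLocallyFiniteMeasure (μs j))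
    (hconv : WeakConv μs μ) {p : Euc d} {ε : ℝ} (hε : 0 < ε) (hp : μ (closedBall p ε) = 0)
    {c : ℝ} (hc : 0 < c) :
    ∀ᶠ j in atTop, (μs j).real (closedBall p (ε / 2)) < c := by
  have hI : ∫ x, max 0 (ε - dist x p) ∂μ < ε / 2 * c := by
    refine (measureReal_closedBall_bump_bounds μ p hε).2.trans_lt ?_
    rw [Measure.real, hp, ENNReal.toReal_zero, mul_zero]
    positivity
  filter_upwards [(hconv.tendsto_bump p ε).eventually (gt_mem_nhds hI)] with j hj
  have := hls j
  exact lt_of_mul_lt_mul_left ((measureReal_closedBall_bump_bounds (μs j) p hε).1.trans_lt hj)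
    (half_pos hε).le

lemma exists_mem_msupport_of_measure_ne_zero {d : ℕ} {ν : Measure (Euc d)} {s : Set (Euc d)}
    (hs : ν s ≠ 0) : ∃ z ∈ s, z ∈ msupport ν := by
  obtain ⟨z, hz, h⟩ := exists_mem_forall_mem_nhdsWithin_pos_measure hs
  exact ⟨z, hz, fun r hr => h _ (mem_nhdsWithin_of_mem_nhds (closedBall_mem_nhds z hr))⟩

lemma DoublingWith.measureReal_closedBall_two_pow_mul_le {d : ℕ} {ν : Measure (Euc d)}
    [IsLocallyFiniteMeasure ν] {C : ℝ} (hC : 0 ≤ C) (h : DoublingWith ν C) {x : Euc d}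
    (hx : x ∈ msupport ν) {r : ℝ} (hr : 0 < r) (k : ℕ) :
    ν.real (closedBall x (2 ^ k * r)) ≤ C ^ k * ν.real (closedBall x r) := by
  induction k with
  | zero => simp
  | succ k ih =>
    have hstep := ENNReal.toReal_mono
      (ENNReal.mul_ne_top ENNReal.ofReal_ne_top measure_closedBall_lt_top.ne)
      (h x hx (2 ^ k * r) (by positivity))
    rw [ENNReal.toReal_mul, ENNReal.toReal_ofReal hC, ← mul_assoc, ← pow_succ'] at hstep
    calc ν.real (closedBall x (2 ^ (k + 1) * r))
        ≤ C * ν.real (closedBall x (2 ^ k * r)) := hstep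
      _ ≤ C * (C ^ k * ν.real (closedBall x r)) := mul_le_mul_of_nonneg_left ih hC
      _ = C ^ (k + 1) * ν.real (closedBall x r) := by ring

lemma WeakConv.eventually_msupport_near {d : ℕ} {μs : ℕ → Measure (Euc d)}
    {μ : Measure (Euc d)} [IsLocallyFiniteMeasure μ] (hls : ∀ j, IsLocallyFiniteMeasure (μs j))
    (hconv : WeakConv μs μ) (x : Euc d) (r : ℝ) {ε : ℝ} (hε : 0 < ε) :
    ∀ᶠ j in atTop, ∀ y ∈ msupport μ ∩ closedBall x r, ∃ z ∈ msupport (μs j), dist y z ≤ ε := by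
  obtain ⟨t, hts, htfin, ht⟩ := finite_approx_of_totallyBounded
    ((isCompact_closedBall x r).totallyBounded.subset
      (inter_subset_right (s := msupport μ))) (ε / 2) (half_pos hε)
  have hev : ∀ᶠ j in atTop, ∀ p ∈ t, μs j (closedBall p (ε / 2)) ≠ 0 := by
    refine htfin.eventually_all.2 fun p hp => ?_
    obtain ⟨c, hc, hj⟩ := hconv.exists_pos_le_measureReal hls (hts hp).1 (half_pos hε)
    filter_upwards [hj] with j hj h0
    rw [Measure.real, h0, ENNReal.toReal_zero] at hj
    linarith
  filter_upwards [hev] with j hj y hy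
  obtain ⟨p, hp, hyp⟩ := mem_iUnion₂.1 (ht hy)
  obtain ⟨z, hz, hzs⟩ := exists_mem_msupport_of_measure_ne_zero (hj p hp)
  refine ⟨z, hzs, (dist_triangle_right y z p).trans ?_⟩
  rw [mem_ball] at hyp
  rw [mem_closedBall] at hz
  linarith

lemma WeakConv.eventually_near_msupport {d : ℕ} {μs : ℕ → Measure (Euc d)}
    {μ : Measure (Euc d)} [IsLocallyFiniteMeasure μ] (hls : ∀ j, IsLocallyFiniteMeasure (μs j))
    (hconv : WeakConv μs μ) {C : ℝ} (hC : 0 < C) (hdoub : ∀ j, DoublingWith (μs j) C)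
    (hμ : (msupport μ).Nonempty) (x : Euc d) (r : ℝ) {ε : ℝ} (hε : 0 < ε) :
    ∀ᶠ j in atTop, ∀ y ∈ msupport (μs j) ∩ closedBall x r, ∃ z ∈ msupport μ, dist y z ≤ ε := by
  obtain ⟨q, hq⟩ := hμ
  obtain ⟨c, hc, hcj⟩ := hconv.exists_pos_le_measureReal hls hq one_pos
  obtain ⟨k, hk⟩ : ∃ k : ℕ, r + dist x q + 1 ≤ 2 ^ k * (ε / 4) := by
    obtain ⟨k, hk⟩ := pow_unbounded_of_one_lt ((r + dist x q + 1) / (ε / 4)) one_lt_two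
    exact ⟨k, ((div_lt_iff₀ (by positivity)).1 hk).le⟩
  obtain ⟨t, hts, htfin, ht⟩ := finite_approx_of_totallyBounded
    ((isCompact_closedBall x r).totallyBounded.subset
      (inter_subset_right (s := {p | ∀ z ∈ msupport μ, ε < dist p z}))) (ε / 4) (by positivity)
  have hev : ∀ᶠ j in atTop, ∀ p ∈ t, (μs j).real (closedBall p (ε / 2)) < c / C ^ k := by
    refine htfin.eventually_all.2 fun p hp =>
      hconv.eventually_measureReal_lt hls hε ?_ (by positivity)
    by_contra h0
    obtain ⟨z, hz, hzs⟩ := exists_mem_msupport_of_measure_ne_zero h0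
    exact ((hts hp).1 z hzs).not_ge (mem_closedBall'.1 hz)
  filter_upwards [hcj, hev] with j hcj hj y hy
  have := hls j
  by_contra! hfar
  obtain ⟨p, hp, hyp⟩ := mem_iUnion₂.1 (ht ⟨hfar, hy.2⟩)
  have hyx := mem_closedBall.1 hy.2
  rw [mem_ball] at hyp
  have hlarge : (μs j).real (closedBall q 1) ≤ (μs j).real (closedBall y (2 ^ k * (ε / 4))) := by
    refine measureReal_mono (closedBall_subset_closedBall' ?_) measure_closedBall_lt_top.ne
    linarith [dist_triangle_left q y x, dist_comm x y]
  have hsmall : (μs j).real (closedBall y (ε / 4)) ≤ (μs j).real (closedBall p (ε / 2)) :=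
    measureReal_mono (closedBall_subset_closedBall' (by linarith)) measure_closedBall_lt_top.ne
  have hdbl := (hdoub j).measureReal_closedBall_two_pow_mul_le hC.le hy.1
    (show 0 < ε / 4 by positivity) k
  have hlt := (lt_div_iff₀' (by positivity)).1 (hsmall.trans_lt (hj p hp))
  linarith

lemma bddBelow_range_iSup_infDist {d n : ℕ} (S : Set (Euc d)) {r : ℝ} (hr : 0 ≤ r) :
    BddBelow (range fun L : nPlanes d n =>
      ⨆ y : S, infDist y.1 (L.1 : Set (Euc d)) / r) :=
  ⟨0, by rintro _ ⟨L, rfl⟩; exact Real.iSup_nonneg fun y => div_nonneg infDist_nonneg hr⟩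

lemma jonesBeta_nonneg {d : ℕ} (n : ℕ) (μ : Measure (Euc d)) (x : Euc d) {r : ℝ} (hr : 0 ≤ r) :
    0 ≤ jonesBeta n μ x r :=
  Real.iInf_nonneg fun _ => Real.iSup_nonneg fun _ => div_nonneg infDist_nonneg hr

lemma exists_mem_nPlanes {d n : ℕ} (hnd : n ≤ d) (x : Euc d) : ∃ L ∈ nPlanes d n, x ∈ L := by
  have hli := (EuclideanSpace.basisFun (Fin d) ℝ).toBasis.linearIndependent.comp _
    (Fin.castLE_injective hnd)
  obtain ⟨V, hV⟩ : ∃ V : Submodule ℝ (Euc d), Module.finrank ℝ V = n :=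
    ⟨_, (finrank_span_eq_card hli).trans (Fintype.card_fin n)⟩
  refine ⟨AffineSubspace.mk' x V, ⟨⟨x, AffineSubspace.self_mem_mk' x V⟩, ?_⟩,
    AffineSubspace.self_mem_mk' x V⟩
  rw [AffineSubspace.direction_mk', hV]

lemma jonesBeta_le_one {d n : ℕ} (hnd : n ≤ d) (μ : Measure (Euc d)) (x : Euc d) {r : ℝ}
    (hr : 0 < r) : jonesBeta n μ x r ≤ 1 := by
  obtain ⟨L, hL, hxL⟩ := exists_mem_nPlanes hnd x
  refine (ciInf_le (bddBelow_range_iSup_infDist _ hr.le) ⟨L, hL⟩).trans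
    (Real.iSup_le (fun y => ?_) zero_le_one)
  exact div_le_one_of_le₀ ((infDist_le_dist_of_mem hxL).trans y.2.2) hr.le

lemma mul_jonesBeta_le_of_near {d n : ℕ} (hnd : n ≤ d) {μ ν : Measure (Euc d)} {x : Euc d}
    {r s ε : ℝ} (hr : 0 < r) (hs : 0 < s) (hε : 0 ≤ ε)
    (h : ∀ y ∈ msupport μ ∩ closedBall x r, ∃ z ∈ msupport ν ∩ closedBall x s, dist y z ≤ ε) :
    r * jonesBeta n μ x r ≤ s * jonesBeta n ν x s + ε := by
  obtain ⟨L₀, hL₀, -⟩ := exists_mem_nPlanes hnd x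
  have : Nonempty (nPlanes d n) := ⟨⟨L₀, hL₀⟩⟩
  suffices (r * jonesBeta n μ x r - ε) / s ≤ jonesBeta n ν x s by
    rw [div_le_iff₀' hs] at this
    linarith
  refine le_ciInf fun L => ?_
  have hbdd : BddAbove (range fun z : (msupport ν ∩ closedBall x s : Set (Euc d)) =>
      infDist z.1 (L.1 : Set (Euc d)) / s) := by
    refine ⟨(infDist x (L.1 : Set (Euc d)) + s) / s, ?_⟩
    rintro _ ⟨z, rfl⟩
    have hz : dist z.1 x ≤ s := z.2.2
    have := infDist_le_infDist_add_dist (s := (L.1 : Set (Euc d))) (x := z.1) (y := x)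
    dsimp only
    gcongr
    linarith
  set G := ⨆ z : (msupport ν ∩ closedBall x s : Set (Euc d)),
    infDist z.1 (L.1 : Set (Euc d)) / s with hG
  have hG0 : 0 ≤ G := Real.iSup_nonneg fun z => div_nonneg infDist_nonneg hs.le
  have hle : jonesBeta n μ x r ≤ (s * G + ε) / r := by
    refine (ciInf_le (bddBelow_range_iSup_infDist _ hr.le) L).trans
      (Real.iSup_le (fun y => ?_) (by positivity))
    obtain ⟨z, hz, hyz⟩ := h y.1 y.2
    have hzG : infDist z (L.1 : Set (Euc d)) / s ≤ G := le_ciSup hbdd ⟨z, hz⟩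
    rw [div_le_iff₀' hs] at hzG
    have := infDist_le_infDist_add_dist (s := (L.1 : Set (Euc d))) (x := y.1) (y := z)
    gcongr
    linarith
  rw [le_div_iff₀' hr] at hle
  rw [div_le_iff₀' hs]
  linarith

theorem jonesBeta_semicontinuity_of_weakConv {d n : ℕ} (hn : 0 < n) (hnd : n ≤ d)
    (μs : ℕ → Measure (Euc d)) (μ : Measure (Euc d))
    [IsLocallyFiniteMeasure μ] (hls : ∀ j, IsLocallyFiniteMeasure (μs j))
    (C : ℝ) (hC : 0 < C)
    (hdoub : ∀ j, DoublingWith (μs j) C) (hdoubμ : DoublingWith μ C)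
    (x₀ : Euc d) (r₀ : ℝ) (hr₀ : 0 < r₀)
    (hS : (msupport μ ∩ Metric.closedBall x₀ r₀).Nonempty)
    (hSj : ∀ j, (msupport (μs j) ∩ Metric.closedBall x₀ r₀).Nonempty)
    (hconv : WeakConv μs μ) :
    (1/2 : ℝ) * Filter.limsup (fun j => jonesBeta n (μs j) x₀ (r₀ / 2)) Filter.atTop
        ≤ jonesBeta n μ x₀ r₀ ∧
    jonesBeta n μ x₀ r₀
        ≤ 2 * Filter.liminf (fun j => jonesBeta n (μs j) x₀ (2 * r₀)) Filter.atTop := by 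
  have hhalf : 0 < r₀ / 2 := half_pos hr₀
  have htwo : 0 < 2 * r₀ := mul_pos two_pos hr₀
  constructor
  · refine le_of_forall_pos_le_add fun ε hε => ?_
    suffices limsup (fun j => jonesBeta n (μs j) x₀ (r₀ / 2)) atTop
        ≤ 2 * (jonesBeta n μ x₀ r₀ + ε) by linarith
    refine limsup_le_of_le
      (isCoboundedUnder_le_of_le atTop fun j => jonesBeta_nonneg n (μs j) x₀ hhalf.le) ?_
    have hδ : 0 < min (r₀ / 2) (r₀ * ε) := lt_min hhalf (mul_pos hr₀ hε)
    filter_upwards [hconv.eventually_near_msupport hls hC hdoub (hS.mono inter_subset_left)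
      x₀ (r₀ / 2) hδ] with j hj
    have key := mul_jonesBeta_le_of_near (n := n) (μ := μs j) (ν := μ) (x := x₀) hnd hhalf hr₀
      (mul_pos hr₀ hε).le fun y hy => by
        obtain ⟨z, hz, hyz⟩ := hj y hy
        refine ⟨z, ⟨hz, ?_⟩, hyz.trans (min_le_right _ _)⟩
        have hyx := mem_closedBall.1 hy.2
        rw [mem_closedBall]
        linarith [dist_triangle_left z x₀ y, min_le_left (r₀ / 2) (r₀ * ε)]
    refine le_of_mul_le_mul_left ?_ hhalf
    linarith
  · refine le_of_forall_pos_le_add fun ε hε => ?_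
    suffices (jonesBeta n μ x₀ r₀ - ε) / 2
        ≤ liminf (fun j => jonesBeta n (μs j) x₀ (2 * r₀)) atTop by linarith
    refine le_liminf_of_le
      (isCoboundedUnder_ge_of_le atTop fun j => jonesBeta_le_one hnd (μs j) x₀ htwo) ?_
    have hδ : 0 < min r₀ (r₀ * ε) := lt_min hr₀ (mul_pos hr₀ hε)
    filter_upwards [hconv.eventually_msupport_near hls x₀ r₀ hδ] with j hj
    have key := mul_jonesBeta_le_of_near (n := n) (μ := μ) (ν := μs j) (x := x₀) hnd hr₀ htwo
      (mul_pos hr₀ hε).le fun y hy => by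
        obtain ⟨z, hz, hyz⟩ := hj y hy
        refine ⟨z, ⟨hz, ?_⟩, hyz.trans (min_le_right _ _)⟩
        have hyx := mem_closedBall.1 hy.2
        rw [mem_closedBall]
        linarith [dist_triangle_left z x₀ y, min_le_left r₀ (r₀ * ε)]
    refine le_of_mul_le_mul_left ?_ htwo
    linarith
end
end

section
/- Let μ be a uniformly distributed measure on ℝ^d with dim₀ μ = n and dim_∞ μ = p, and let R > 0. Then there exists C > 0, depending only on R, μ, n and d, such that for every z ∈ supp μ and all 0 < r₀ < r ≤ R: ∫_{r₀ < |y−z| ≤ r} |y−z|^{−n} dμ(y) ≤ C(1 + log(r/r₀)); in particular the truncated Riesz transform satisfies |R_{r₀,r}μ(z)| ≤ C(1 + log(r/r₀)). -/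
open MeasureTheory Metric Filter Set

noncomputable section

lemma IsDistributionFunction.exists_le_mul_pow {d n : ℕ} {μ : Measure (Euc d)} {φ : ℝ → ENNReal}
    (hφ : IsDistributionFunction μ φ) (hn : HasDim0 φ n) (R : ℝ) :
    ∃ A : ℝ, 0 < A ∧ ∀ z ∈ msupport μ, ∀ r : ℝ, 0 < r → r ≤ R →
      μ (closedBall z r) ≤ ENNReal.ofReal (A * r ^ n) := by
  obtain ⟨⟨w, hw⟩, hfin, hball⟩ := hφ
  obtain ⟨c, hc, hlim⟩ := hn
  have hev : ∀ᶠ r in nhdsWithin (0 : ℝ) (Ioi 0), (φ r).toReal / r ^ n < c + 1 :=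
    hlim.eventually (gt_mem_nhds (lt_add_one c))
  obtain ⟨δ, hδ, hsub⟩ := mem_nhdsGT_iff_exists_Ioo_subset.1 hev
  have hδ0 : 0 < δ := hδ
  refine ⟨max (c + 1) ((φ R).toReal / δ ^ n), lt_max_of_lt_left (by linarith), ?_⟩
  intro z hz r hr hrR
  rw [hball z hz r hr]
  refine (ENNReal.le_ofReal_iff_toReal_le (hfin r hr).2.ne (by positivity)).2 ?_
  rcases lt_or_ge r δ with h | h
  · have h1 : (φ r).toReal / r ^ n < c + 1 := hsub ⟨hr, h⟩
    rw [div_lt_iff₀ (by positivity)] at h1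
    exact h1.le.trans (by gcongr; exact le_max_left _ _)
  · have hR : 0 < R := hr.trans_le hrR
    have h1 : (φ r).toReal ≤ (φ R).toReal := by
      refine ENNReal.toReal_mono (hfin R hR).2.ne ?_
      rw [← hball w hw r hr, ← hball w hw R hR]
      exact measure_mono (closedBall_subset_closedBall hrR)
    calc (φ r).toReal ≤ (φ R).toReal / δ ^ n * δ ^ n := by
          rwa [div_mul_cancel₀ _ (by positivity)]
      _ ≤ max (c + 1) ((φ R).toReal / δ ^ n) * r ^ n := by
          gcongr
          exact le_max_right _ _

lemma measurableSet_closed_annulus {X : Type*} [PseudoMetricSpace X] [MeasurableSpace X]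
    [OpensMeasurableSpace X] (z : X) (ρ r : ℝ) :
    MeasurableSet {y : X | ρ ≤ dist y z ∧ dist y z ≤ r} :=
  ((isClosed_le continuous_const (continuous_id.dist continuous_const)).inter
    (isClosed_le (continuous_id.dist continuous_const) continuous_const)).measurableSet

/-- A power growth bound at `z` gives a linear bound, in the number of dyadic scales, for the
integral of `dist y z ^ (-n)` over a closed annulus. -/
lemma lintegral_annulus_le_of_le_two_pow {X : Type*} [PseudoMetricSpace X] [MeasurableSpace X]
    [OpensMeasurableSpace X] {μ : Measure X} {n : ℕ} {A R : ℝ} (hA : 0 ≤ A) {z : X}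
    (hgrowth : ∀ r : ℝ, 0 < r → r ≤ R → μ (closedBall z r) ≤ ENNReal.ofReal (A * r ^ n)) (k : ℕ) :
    ∀ ρ r : ℝ, 0 < ρ → ρ ≤ r → r ≤ R → r ≤ 2 ^ (k + 1) * ρ →
      ∫⁻ y in {y : X | ρ ≤ dist y z ∧ dist y z ≤ r}, ENNReal.ofReal ((dist y z ^ n)⁻¹) ∂μ
        ≤ ENNReal.ofReal ((k + 1) * (A * 2 ^ n)) := by
  have single : ∀ ρ r : ℝ, 0 < ρ → ρ ≤ r → r ≤ R → r ≤ 2 * ρ →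
      ∫⁻ y in {y : X | ρ ≤ dist y z ∧ dist y z ≤ r}, ENNReal.ofReal ((dist y z ^ n)⁻¹) ∂μ
        ≤ ENNReal.ofReal (A * 2 ^ n) := by
    intro ρ r hρ hρr hrR hr
    calc ∫⁻ y in {y : X | ρ ≤ dist y z ∧ dist y z ≤ r}, ENNReal.ofReal ((dist y z ^ n)⁻¹) ∂μ
        ≤ ∫⁻ _ in {y : X | ρ ≤ dist y z ∧ dist y z ≤ r}, ENNReal.ofReal ((ρ ^ n)⁻¹) ∂μ := by
          refine setLIntegral_mono' (measurableSet_closed_annulus z ρ r) fun y hy => ?_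
          have := hy.1
          gcongr
      _ = ENNReal.ofReal ((ρ ^ n)⁻¹) * μ {y : X | ρ ≤ dist y z ∧ dist y z ≤ r} := by
          rw [setLIntegral_const]
      _ ≤ ENNReal.ofReal ((ρ ^ n)⁻¹) * ENNReal.ofReal (A * r ^ n) := by
          gcongr
          exact (measure_mono fun y hy => hy.2).trans (hgrowth r (hρ.trans_le hρr) hrR)
      _ = ENNReal.ofReal ((ρ ^ n)⁻¹ * (A * r ^ n)) := by
          rw [← ENNReal.ofReal_mul (by positivity)]
      _ ≤ ENNReal.ofReal (A * 2 ^ n) := by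
          refine ENNReal.ofReal_le_ofReal ?_
          have hr0 : 0 ≤ r := hρ.le.trans hρr
          calc (ρ ^ n)⁻¹ * (A * r ^ n) ≤ (ρ ^ n)⁻¹ * (A * (2 * ρ) ^ n) := by gcongr
            _ = A * 2 ^ n := by
              rw [mul_pow]
              field_simp
  induction k with
  | zero =>
    intro ρ r hρ hρr hrR hr
    simpa using single ρ r hρ hρr hrR (by simpa using hr)
  | succ k ih =>
    intro ρ r hρ hρr hrR hr
    rcases le_total r (2 * ρ) with h | h
    · refine (single ρ r hρ hρr hrR h).trans (ENNReal.ofReal_le_ofReal ?_)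
      refine le_mul_of_one_le_left (by positivity) ?_
      push_cast
      linarith [(k.cast_nonneg : (0 : ℝ) ≤ k)]
    · have hsub : {y : X | ρ ≤ dist y z ∧ dist y z ≤ r} ⊆
          {y : X | ρ ≤ dist y z ∧ dist y z ≤ 2 * ρ} ∪
            {y : X | 2 * ρ ≤ dist y z ∧ dist y z ≤ r} := by
        rintro y ⟨h1, h2⟩
        rcases le_total (dist y z) (2 * ρ) with h3 | h3
        · exact Or.inl ⟨h1, h3⟩
        · exact Or.inr ⟨h3, h2⟩
      refine (lintegral_mono_set hsub).trans ((lintegral_union_le _ _ _).trans ?_)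
      refine (add_le_add (single ρ (2 * ρ) hρ (by linarith) (h.trans hrR) le_rfl)
        (ih (2 * ρ) r (by positivity) h hrR (by rw [pow_succ] at hr; linarith))).trans ?_
      rw [← ENNReal.ofReal_add (by positivity) (by positivity)]
      refine ENNReal.ofReal_le_ofReal (le_of_eq ?_)
      push_cast
      ring

lemma exists_nat_le_two_pow_mul {r₀ r : ℝ} (hr₀ : 0 < r₀) (hr : r₀ ≤ r) :
    ∃ k : ℕ, r ≤ 2 ^ (k + 1) * r₀ ∧ (k + 1 : ℝ) ≤ 2 * (1 + Real.log (r / r₀)) := by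
  have hlog : 0 ≤ Real.log (r / r₀) := Real.log_nonneg ((one_le_div hr₀).2 hr)
  have h2 : (1 / 2 : ℝ) < Real.log 2 := by linarith [Real.log_two_gt_d9]
  refine ⟨⌊2 * Real.log (r / r₀)⌋₊, ?_, ?_⟩
  · rw [← div_le_iff₀ hr₀, ← Real.log_le_log_iff (by have := hr₀.trans_le hr; positivity)
      (by positivity), Real.log_pow]
    push_cast
    nlinarith [Nat.lt_floor_add_one (2 * Real.log (r / r₀))]
  · linarith [Nat.floor_le (mul_nonneg zero_le_two hlog)]

lemma enorm_rieszT_le {d : ℕ} (n : ℕ) (μ : Measure (Euc d)) (z : Euc d) (r s : ℝ) :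
    ‖rieszT n μ z r s‖ₑ ≤
      ∫⁻ y in {y : Euc d | r ≤ dist y z ∧ dist y z ≤ s}, ENNReal.ofReal ((dist y z ^ n)⁻¹) ∂μ := by
  refine (enorm_integral_le_lintegral_enorm _).trans (lintegral_mono fun y => ?_)
  rw [← ofReal_norm, norm_smul, norm_inv, norm_pow, norm_norm, dist_eq_norm]
  refine ENNReal.ofReal_le_ofReal ?_
  rw [pow_succ, mul_inv, mul_assoc]
  exact mul_le_of_le_one_right (by positivity) inv_mul_le_one

theorem riesz_log_bound {d n p : ℕ}
    (μ : Measure (Euc d)) [IsLocallyFiniteMeasure μ]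
    (φ : ℝ → ENNReal) (hφ : IsDistributionFunction μ φ)
    (hn : HasDim0 φ n) (hp : HasDimInfty φ p) (R : ℝ) (hR : 0 < R) :
    ∃ C : ℝ, 0 < C ∧ ∀ z ∈ msupport μ, ∀ r₀ r : ℝ, 0 < r₀ → r₀ < r → r ≤ R →
      (∫⁻ y in {y : Euc d | r₀ < dist y z ∧ dist y z ≤ r},
          ENNReal.ofReal ((dist y z ^ n)⁻¹) ∂μ
        ≤ ENNReal.ofReal (C * (1 + Real.log (r / r₀)))) ∧
      ‖rieszT n μ z r₀ r‖ ≤ C * (1 + Real.log (r / r₀)) := by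
  obtain ⟨A, hA, hgrowth⟩ := hφ.exists_le_mul_pow hn R
  refine ⟨2 * (A * 2 ^ n), by positivity, fun z hz r₀ r hr₀ hr hrR => ?_⟩
  obtain ⟨k, hk, hklog⟩ := exists_nat_le_two_pow_mul hr₀ hr.le
  have hclosed : ∫⁻ y in {y : Euc d | r₀ ≤ dist y z ∧ dist y z ≤ r},
      ENNReal.ofReal ((dist y z ^ n)⁻¹) ∂μ
        ≤ ENNReal.ofReal (2 * (A * 2 ^ n) * (1 + Real.log (r / r₀))) := by
    refine (lintegral_annulus_le_of_le_two_pow hA.le (hgrowth z hz) k r₀ r hr₀ hr.le hrR hk).trans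
      (ENNReal.ofReal_le_ofReal ?_)
    calc (k + 1) * (A * 2 ^ n) ≤ 2 * (1 + Real.log (r / r₀)) * (A * 2 ^ n) := by gcongr
      _ = 2 * (A * 2 ^ n) * (1 + Real.log (r / r₀)) := by ring
  have hlog : 0 ≤ Real.log (r / r₀) := Real.log_nonneg ((one_le_div hr₀).2 hr.le)
  have hsub : {y : Euc d | r₀ < dist y z ∧ dist y z ≤ r} ⊆
      {y : Euc d | r₀ ≤ dist y z ∧ dist y z ≤ r} := fun y hy => ⟨hy.1.le, hy.2⟩
  refine ⟨(lintegral_mono_set hsub).trans hclosed, ?_⟩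
  have h := (enorm_rieszT_le n μ z r₀ r).trans hclosed
  rw [← ofReal_norm] at h
  exact (ENNReal.ofReal_le_ofReal_iff (by positivity)).1 h
end
end
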